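/- arXiv:1304.0015 — 4 statements merged into one kernel-verified Lean document; each statement's English description precedes it below -/
import Mathlib

section
/- For every natural number k ≥ 1 and every ħ ∈ ℂ with Re(ħ) < 0, the series Σ_{m=0}^∞ (m!)^k · exp(½·m·(m−1)·ħ) · (ħ^k · x)^m converges absolutely for every x ∈ ℂ; consequently the function x ↦ Z_k(x, ħ) it defines is analytic on all of ℂ (an entire function of x). -/
/-- The `m`-th term of the series defining the partition function. -/
noncomputable def partitionTerm (k : ℕ) (hbar x : ℂ) (m : ℕ) : ℂ :=
  (m.factorial : ℂ) ^ k * Complex.exp ((m : ℂ) * ((m : ℂ) - 1) / 2 * hbar) * (hbar ^ k * x) ^ m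

theorem partitionTerm_succ (k : ℕ) (hbar x : ℂ) (m : ℕ) :
    partitionTerm k hbar x (m + 1) =
      ((m + 1 : ℕ) : ℂ) ^ k * Complex.exp (m * hbar) * (hbar ^ k * x) *
        partitionTerm k hbar x m := by
  have hexp : Complex.exp (((m + 1 : ℕ) : ℂ) * (((m + 1 : ℕ) : ℂ) - 1) / 2 * hbar) =
      Complex.exp (m * hbar) * Complex.exp ((m : ℂ) * ((m : ℂ) - 1) / 2 * hbar) := by
    rw [← Complex.exp_add]
    congr 1
    push_cast
    ring
  rw [partitionTerm, partitionTerm, hexp, Nat.factorial_succ, Nat.cast_mul, mul_pow, pow_succ]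
  ring

theorem tendsto_norm_partitionTerm_ratio (k : ℕ) {hbar : ℂ} (hh : hbar.re < 0) (x : ℂ) :
    Filter.Tendsto
      (fun m : ℕ => ‖((m + 1 : ℕ) : ℂ) ^ k * Complex.exp (m * hbar) * (hbar ^ k * x)‖)
      Filter.atTop (nhds 0) := by
  have hr : |Real.exp hbar.re| < 1 := by
    rwa [abs_of_pos (Real.exp_pos _), Real.exp_lt_one_iff]
  have h := ((tendsto_pow_const_mul_const_pow_of_abs_lt_one k hr).comp
    (Filter.tendsto_add_atTop_nat 1)).mul_const ((Real.exp hbar.re)⁻¹ * ‖hbar ^ k * x‖)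
  rw [zero_mul] at h
  refine h.congr fun m => ?_
  have hexp : ‖Complex.exp (m * hbar)‖ = Real.exp hbar.re ^ m := by
    rw [Complex.exp_nat_mul, norm_pow, Complex.norm_exp]
  simp only [norm_mul, norm_pow, Complex.norm_natCast, hexp, Function.comp_apply, pow_succ]
  field_simp [(Real.exp_pos hbar.re).ne']

theorem summable_norm_partitionTerm (k : ℕ) {hbar : ℂ} (hh : hbar.re < 0) (x : ℂ) :
    Summable fun m => ‖partitionTerm k hbar x m‖ := by
  refine summable_of_ratio_norm_eventually_le (r := 1 / 2) (by norm_num) ?_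
  filter_upwards [(tendsto_norm_partitionTerm_ratio k hh x).eventually_le_const
    (show (0 : ℝ) < 1 / 2 by norm_num)] with m hm
  rw [norm_norm, norm_norm, partitionTerm_succ, norm_mul]
  gcongr

theorem norm_partitionTerm_le (k : ℕ) (hbar : ℂ) {x y : ℂ} (hxy : ‖x‖ ≤ ‖y‖) (m : ℕ) :
    ‖partitionTerm k hbar x m‖ ≤ ‖partitionTerm k hbar y m‖ := by
  simp only [partitionTerm, norm_mul, norm_pow]
  gcongr

theorem differentiable_tsum_partitionTerm (k : ℕ) {hbar : ℂ} (hh : hbar.re < 0) :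
    Differentiable ℂ fun x => ∑' m, partitionTerm k hbar x m := by
  intro x
  have hball : DifferentiableOn ℂ (fun y => ∑' m, partitionTerm k hbar y m)
      (Metric.ball 0 (‖x‖ + 1)) := by
    refine Complex.differentiableOn_tsum_of_summable_norm
      (summable_norm_partitionTerm k hh ((‖x‖ + 1 : ℝ) : ℂ)) (fun m => ?_)
      Metric.isOpen_ball fun m y hy => norm_partitionTerm_le k hbar ?_ m
    · unfold partitionTerm
      fun_prop
    · rw [Complex.norm_of_nonneg (by positivity)]
      exact (mem_ball_zero_iff.mp hy).le
  exact hball.differentiableAt (Metric.isOpen_ball.mem_nhds (by simp))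

/-- For `k ≥ 1` and `Re hbar < 0`, the series defining the partition function
`Z_k(x, hbar) = Σ_m (m!)^k · exp(½ m (m-1) hbar) · (hbar^k x)^m` converges absolutely for
every `x ∈ ℂ`, and the function `x ↦ Z_k(x, hbar)` is analytic on all of `ℂ`. -/
theorem partitionFunction_summable_and_entire (k : ℕ) (hk : 1 ≤ k) (hbar : ℂ)
    (hh : hbar.re < 0) :
    (∀ x : ℂ,
      Summable (fun m : ℕ =>
        ‖(m.factorial : ℂ) ^ k * Complex.exp ((m : ℂ) * ((m : ℂ) - 1) / 2 * hbar) *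
          (hbar ^ k * x) ^ m‖)) ∧
    AnalyticOnNhd ℂ
      (fun x : ℂ => ∑' m : ℕ,
        (m.factorial : ℂ) ^ k * Complex.exp ((m : ℂ) * ((m : ℂ) - 1) / 2 * hbar) *
          (hbar ^ k * x) ^ m)
      Set.univ := by
  exact ⟨summable_norm_partitionTerm k hh,
    (differentiable_tsum_partitionTerm k hh).differentiableOn.analyticOnNhd isOpen_univ⟩
end

section
/- Let k ≥ 1 be a natural number and ħ ∈ ℂ with Re(ħ) < 0, and let Z_k(x, ħ) = Σ_{m=0}^∞ (m!)^k · exp(½·m·(m−1)·ħ) · (ħ^k · x)^m. Let L denote the operator on entire functions defined by (L f)(x) = d/dx (x · f(x)), and let L^k be its k-fold iterate. Then for every x ∈ ℂ: Z_k(x, ħ) − ħ^k · x · (L^k (Z_k(·, ħ)))(e^ħ · x) = 1. -/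
/-- The operator `L` sending an entire function `f` to `x ↦ d/dx (x · f(x))`,
written `(d/dx)·x` in the paper. -/
noncomputable def Lop (f : ℂ → ℂ) : ℂ → ℂ := fun x => deriv (fun t => t * f t) x

/-- If a power series converges everywhere, `Lop` acts on it termwise, multiplying the coefficient
of `y ^ m` by `m + 1`. -/
theorem hasSum_Lop_tsum {a : ℕ → ℂ} (ha : ∀ y : ℂ, Summable fun m => a m * y ^ m) (y : ℂ) :
    HasSum (fun m : ℕ => ((m : ℂ) + 1) * a m * y ^ m) (Lop (fun t => ∑' m, a m * t ^ m) y) := by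
  have hR : 0 ≤ ‖y‖ + 1 := by positivity
  have hu : Summable fun m => (‖y‖ + 1) * ‖a m * ((‖y‖ + 1 : ℝ) : ℂ) ^ m‖ :=
    (ha _).norm.mul_left _
  have h := Complex.hasSum_deriv_of_summable_norm (F := fun m t => t * (a m * t ^ m))
    (U := Metric.ball 0 (‖y‖ + 1)) (z := y) hu (fun m => by fun_prop) Metric.isOpen_ball
    (fun m w hw => by
      have hw' : ‖w‖ ≤ ‖y‖ + 1 := (mem_ball_zero_iff.mp hw).le
      simp only [norm_mul, norm_pow, Complex.norm_of_nonneg hR]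
      gcongr)
    (by simp)
  simp only [tsum_mul_left] at h
  have hd (m : ℕ) : deriv (fun t : ℂ => t * (a m * t ^ m)) y = ((m : ℂ) + 1) * a m * y ^ m := by
    have hf : (fun t : ℂ => t * (a m * t ^ m)) = fun t => a m * t ^ (m + 1) := by
      ext t
      ring
    rw [hf, ((hasDerivAt_pow (m + 1) y).const_mul (a m)).deriv]
    simp only [Nat.add_sub_cancel, Nat.cast_add, Nat.cast_one]
    ring
  simpa only [hd] using! h

/-- Iterating `Lop` on an everywhere convergent power series. -/
theorem Lop_iterate_tsum {a : ℕ → ℂ} (ha : ∀ y : ℂ, Summable fun m => a m * y ^ m) (k : ℕ) :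
    (∀ y : ℂ, Summable fun m : ℕ => ((m : ℂ) + 1) ^ k * a m * y ^ m) ∧
      Lop^[k] (fun t => ∑' m, a m * t ^ m) =
        fun y => ∑' m : ℕ, ((m : ℂ) + 1) ^ k * a m * y ^ m := by
  induction k with
  | zero => simpa using ha
  | succ k ih =>
    obtain ⟨hs, he⟩ := ih
    have h (y : ℂ) := hasSum_Lop_tsum hs y
    simp only [← mul_assoc, ← pow_succ'] at h
    refine ⟨fun y => (h y).summable, ?_⟩
    rw [Function.iterate_succ_apply', he]
    ext y
    exact (h y).tsum_eq.symm

/-- The coefficient of `y ^ m` in `Z_k(y, hbar)`. -/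
noncomputable def partitionCoeff (k : ℕ) (hbar : ℂ) (m : ℕ) : ℂ :=
  (m.factorial : ℂ) ^ k * Complex.exp ((m : ℂ) * ((m : ℂ) - 1) / 2 * hbar) * (hbar ^ k) ^ m

theorem partitionCoeff_zero (k : ℕ) (hbar : ℂ) : partitionCoeff k hbar 0 = 1 := by
  simp [partitionCoeff]

theorem partitionCoeff_succ (k : ℕ) (hbar : ℂ) (m : ℕ) :
    partitionCoeff k hbar (m + 1) =
      hbar ^ k * (((m : ℂ) + 1) ^ k * Complex.exp hbar ^ m) * partitionCoeff k hbar m := by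
  have he : Complex.exp (((m + 1 : ℕ) : ℂ) * (((m + 1 : ℕ) : ℂ) - 1) / 2 * hbar) =
      Complex.exp hbar ^ m * Complex.exp ((m : ℂ) * ((m : ℂ) - 1) / 2 * hbar) := by
    rw [← Complex.exp_nat_mul, ← Complex.exp_add]
    congr 1
    push_cast
    ring
  rw [partitionCoeff, partitionCoeff, he, Nat.factorial_succ]
  push_cast [mul_pow]
  ring

open Filter Topology in
theorem summable_partitionCoeff (k : ℕ) {hbar : ℂ} (hh : hbar.re < 0) (y : ℂ) :
    Summable fun m => partitionCoeff k hbar m * y ^ m := by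
  have hr : ‖Complex.exp hbar‖ < 1 := by
    rw [Complex.norm_exp]
    exact Real.exp_lt_one_iff.mpr hh
  have hlim : Tendsto (fun m : ℕ => ‖hbar ^ k * (((m : ℂ) + 1) ^ k * Complex.exp hbar ^ m) * y‖)
      atTop (𝓝 0) := by
    have h := ((tendsto_pow_const_mul_const_pow_of_abs_lt_one k
      ((abs_norm _).trans_lt hr)).comp (tendsto_add_atTop_nat 1)).const_mul
        (‖hbar ^ k‖ * ‖y‖ * ‖Complex.exp hbar‖⁻¹)
    rw [mul_zero] at h
    refine h.congr fun m => ?_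
    have h0 : ‖Complex.exp hbar‖ ≠ 0 := norm_ne_zero_iff.mpr (Complex.exp_ne_zero _)
    have hm : ‖(m : ℂ) + 1‖ = (m : ℝ) + 1 := by exact_mod_cast Complex.norm_natCast (m + 1)
    simp only [Function.comp_apply, norm_mul, norm_pow, hm, pow_succ, Nat.cast_add, Nat.cast_one]
    field_simp
  refine summable_of_ratio_norm_eventually_le (r := 1 / 2) (by norm_num) ?_
  filter_upwards [hlim.eventually_le_const (by norm_num : (0 : ℝ) < 1 / 2)] with m hm
  calc ‖partitionCoeff k hbar (m + 1) * y ^ (m + 1)‖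
      = ‖hbar ^ k * (((m : ℂ) + 1) ^ k * Complex.exp hbar ^ m) * y‖ *
          ‖partitionCoeff k hbar m * y ^ m‖ := by
        rw [partitionCoeff_succ, ← norm_mul]
        congr 1
        ring
    _ ≤ 1 / 2 * ‖partitionCoeff k hbar m * y ^ m‖ := by gcongr

/-- With `Z_k(x, hbar) = Σ_m (m!)^k · exp(½ m (m-1) hbar) · (hbar^k x)^m`, for every `x ∈ ℂ`
one has `Z_k(x, hbar) − hbar^k · x · (L^k Z_k(·, hbar))(e^hbar · x) = 1`. -/
theorem partitionFunction_functional_equation (k : ℕ) (hk : 1 ≤ k) (hbar : ℂ)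
    (hh : hbar.re < 0) (x : ℂ) :
    (fun y : ℂ => ∑' m : ℕ,
        (m.factorial : ℂ) ^ k * Complex.exp ((m : ℂ) * ((m : ℂ) - 1) / 2 * hbar) *
          (hbar ^ k * y) ^ m) x
      - hbar ^ k * x *
        (Lop^[k] (fun y : ℂ => ∑' m : ℕ,
          (m.factorial : ℂ) ^ k * Complex.exp ((m : ℂ) * ((m : ℂ) - 1) / 2 * hbar) *
            (hbar ^ k * y) ^ m)) (Complex.exp hbar * x) = 1 := by
  have hZ : (fun y : ℂ => ∑' m : ℕ,
      (m.factorial : ℂ) ^ k * Complex.exp ((m : ℂ) * ((m : ℂ) - 1) / 2 * hbar) *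
        (hbar ^ k * y) ^ m) = fun y => ∑' m, partitionCoeff k hbar m * y ^ m := by
    simp only [partitionCoeff, mul_pow, mul_assoc]
  have hs := summable_partitionCoeff k hh
  rw [hZ, (Lop_iterate_tsum hs k).2]
  dsimp only
  rw [(hs x).tsum_eq_zero_add, partitionCoeff_zero, ← tsum_mul_left, pow_zero, mul_one,
    sub_eq_iff_eq_add, add_right_inj]
  congr 1
  ext m
  rw [partitionCoeff_succ]
  ring
end

section
/- Fix a natural number k, a point u ∈ ℂ, and functions S₀, S₁ : ℂ → ℂ twice differentiable at u. For real t < 0 set f(u, t) = exp( S₀(u)/t + S₁(u) ) and let Q act by (Q f)(u, t) = ∂f/∂ħ|_{ħ=t} − ½ ∂²f/∂u² + (½ − k/t) ∂f/∂u. If the function t ↦ e^{−S₀(u)/t − S₁(u)} · (Q f)(u, t) remains bounded as t → 0⁻ (t real, negative), then necessarily S₀(u) + ½ S₀′(u)² + k S₀′(u) = 0 and ½ S₀″(u) − ½ S₀′(u) + S₀′(u) S₁′(u) + k S₁′(u) = 0. -/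
open Filter Topology

theorem ContDiffAt.hasDerivAt_deriv {f : ℂ → ℂ} {u : ℂ} (hf : ContDiffAt ℂ 2 f u) :
    HasDerivAt (deriv f) (deriv (deriv f) u) u :=
  ((hf.derivWithin (m := 1) (by norm_num)).differentiableAt
    (by norm_num)).hasDerivAt

theorem ContDiffAt.eventually_hasDerivAt {f : ℂ → ℂ} {u : ℂ} (hf : ContDiffAt ℂ 2 f u) :
    ∀ᶠ v in 𝓝 u, HasDerivAt f (deriv f v) v :=
  (hf.eventually (by simp)).mono fun _ hv => (hv.differentiableAt (by norm_num)).hasDerivAt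

section WKB

variable {S₀ S₁ : ℂ → ℂ} {u : ℂ}

theorem eventually_hasDerivAt_wkb (hS₀ : ContDiffAt ℂ 2 S₀ u) (hS₁ : ContDiffAt ℂ 2 S₁ u)
    (h : ℂ) :
    ∀ᶠ v in 𝓝 u, HasDerivAt (fun s => Complex.exp (S₀ s / h + S₁ s))
      (Complex.exp (S₀ v / h + S₁ v) * (deriv S₀ v / h + deriv S₁ v)) v := by
  filter_upwards [hS₀.eventually_hasDerivAt, hS₁.eventually_hasDerivAt] with v h₀ h₁
  exact ((h₀.div_const h).add h₁).cexp

theorem deriv_deriv_wkb (hS₀ : ContDiffAt ℂ 2 S₀ u) (hS₁ : ContDiffAt ℂ 2 S₁ u) (h : ℂ) :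
    deriv (fun v => deriv (fun s => Complex.exp (S₀ s / h + S₁ s)) v) u =
      Complex.exp (S₀ u / h + S₁ u) * ((deriv S₀ u / h + deriv S₁ u) ^ 2 +
        (deriv (deriv S₀) u / h + deriv (deriv S₁) u)) := by
  have hev := eventually_hasDerivAt_wkb hS₀ hS₁ h
  rw [EventuallyEq.deriv_eq (hev.mono fun v hv => hv.deriv)]
  refine (hev.self_of_nhds.mul
    ((hS₀.hasDerivAt_deriv.div_const h).add hS₁.hasDerivAt_deriv)).deriv.trans ?_
  simp only [Pi.add_apply]
  ring

theorem deriv_exp_div_add {a b h : ℂ} (hh : h ≠ 0) :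
    deriv (fun z : ℂ => Complex.exp (a / z + b)) h =
      Complex.exp (a / h + b) * (-a / h ^ 2) := by
  have hd : HasDerivAt (fun z : ℂ => a / z + b) (-a / h ^ 2) h := by
    simpa [div_eq_mul_inv] using ((hasDerivAt_inv hh).const_mul a).add_const b
  exact hd.cexp.deriv

/-- Conjugating the Schrödinger operator by the two-term WKB exponential gives a quadratic
polynomial in `h⁻¹`. -/
theorem wkb_conjugation (hS₀ : ContDiffAt ℂ 2 S₀ u) (hS₁ : ContDiffAt ℂ 2 S₁ u) (k : ℂ)
    {h : ℂ} (hh : h ≠ 0) :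
    Complex.exp (-(S₀ u) / h - S₁ u) *
        (deriv (fun z : ℂ => Complex.exp (S₀ u / z + S₁ u)) h
          - (1 / 2) * deriv (fun v => deriv (fun s => Complex.exp (S₀ s / h + S₁ s)) v) u
          + (1 / 2 - k / h) * deriv (fun s => Complex.exp (S₀ s / h + S₁ s)) u) =
      -(S₀ u + (1 / 2) * (deriv S₀ u) ^ 2 + k * deriv S₀ u) / h ^ 2
        + -((1 / 2) * deriv (deriv S₀) u - (1 / 2) * deriv S₀ u
          + deriv S₀ u * deriv S₁ u + k * deriv S₁ u) / h
        + ((1 / 2) * deriv S₁ u - (1 / 2) * (deriv S₁ u ^ 2 + deriv (deriv S₁) u)) := by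
  have hexp : Complex.exp (-(S₀ u) / h - S₁ u) * Complex.exp (S₀ u / h + S₁ u) = 1 := by
    rw [← Complex.exp_add, ← Complex.exp_zero]
    congr 1
    ring
  rw [deriv_exp_div_add hh, deriv_deriv_wkb hS₀ hS₁,
    (eventually_hasDerivAt_wkb hS₀ hS₁ h).self_of_nhds.deriv]
  linear_combination (-S₀ u / h ^ 2 - (1 / 2) * ((deriv S₀ u / h + deriv S₁ u) ^ 2 +
    (deriv (deriv S₀) u / h + deriv (deriv S₁) u)) +
    (1 / 2 - k / h) * (deriv S₀ u / h + deriv S₁ u)) * hexp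

end WKB

/-- A function vanishes in the limit if it is a multiple, by a null function, of a bounded one. -/
theorem eq_zero_of_tendsto_mul_bounded {ι : Type*} {l : Filter ι} [l.NeBot] {f g p : ι → ℂ} {a : ℂ}
    {M : ℝ} (hg : ∀ᶠ t in l, ‖g t‖ ≤ M) (hp : Tendsto p l (𝓝 0))
    (hf : Tendsto f l (𝓝 a)) (hfg : ∀ᶠ t in l, p t * g t = f t) : a = 0 :=
  tendsto_nhds_unique hf <|
    (hp.zero_mul_isBoundedUnder_le (isBoundedUnder_of_eventually_le hg)).congr' hfg

/-- A polynomial in `h⁻¹` of degree at most two that stays bounded as `h → 0` is constant. -/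
theorem eq_zero_of_bounded_div_sq_add_div {ι : Type*} {l : Filter ι} [l.NeBot] {h : ι → ℂ}
    (hh : Tendsto h l (𝓝 0)) (hne : ∀ᶠ t in l, h t ≠ 0) {a b c : ℂ} {M : ℝ}
    (hM : ∀ᶠ t in l, ‖a / h t ^ 2 + b / h t + c‖ ≤ M) : a = 0 ∧ b = 0 := by
  have ha : a = 0 := by
    refine eq_zero_of_tendsto_mul_bounded (p := fun t => h t ^ 2)
      (f := fun t => a + b * h t + c * h t ^ 2) hM (by simpa using hh.pow 2) ?_ ?_
    · simpa using ((hh.const_mul b).const_add a).add ((hh.pow 2).const_mul c)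
    · filter_upwards [hne] with t ht
      field_simp
  refine ⟨ha, eq_zero_of_tendsto_mul_bounded (f := fun t => b + c * h t) hM hh ?_ ?_⟩
  · simpa using (hh.const_mul c).const_add b
  · filter_upwards [hne] with t ht
    rw [ha]
    field_simp
    ring

/-- The semi-classical limit of the Schrödinger operator: fix `k`, `u ∈ ℂ`, and `S₀, S₁`
twice differentiable at `u`.  With `f(u, t) = exp(S₀(u)/t + S₁(u))` for real `t < 0` and
`(Q f)(u, t) = ∂f/∂hbar|_{hbar = t} − ½ ∂²f/∂u² + (½ − k/t) ∂f/∂u`, if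
`t ↦ e^{−S₀(u)/t − S₁(u)} (Q f)(u, t)` remains bounded as `t → 0⁻`, then
`S₀ + ½ S₀′² + k S₀′ = 0` and `½ S₀″ − ½ S₀′ + S₀′ S₁′ + k S₁′ = 0` at `u`. -/
theorem semiclassical_limit_equations (k : ℕ) (u : ℂ) (S₀ S₁ : ℂ → ℂ)
    (hS₀ : ContDiffAt ℂ 2 S₀ u) (hS₁ : ContDiffAt ℂ 2 S₁ u)
    (hbdd : ∃ M : ℝ, ∀ᶠ t : ℝ in nhdsWithin 0 (Set.Iio 0),
      ‖Complex.exp (-(S₀ u) / (t : ℂ) - S₁ u) *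
        (deriv (fun h : ℂ => Complex.exp (S₀ u / h + S₁ u)) (t : ℂ)
          - (1 / 2) *
              deriv (fun v : ℂ =>
                deriv (fun s : ℂ => Complex.exp (S₀ s / (t : ℂ) + S₁ s)) v) u
          + (1 / 2 - (k : ℂ) / (t : ℂ)) *
              deriv (fun s : ℂ => Complex.exp (S₀ s / (t : ℂ) + S₁ s)) u)‖ ≤ M) :
    S₀ u + (1 / 2) * (deriv S₀ u) ^ 2 + (k : ℂ) * deriv S₀ u = 0 ∧
    (1 / 2) * deriv (deriv S₀) u - (1 / 2) * deriv S₀ u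
      + deriv S₀ u * deriv S₁ u + (k : ℂ) * deriv S₁ u = 0 := by
  obtain ⟨M, hM⟩ := hbdd
  have hne : ∀ᶠ t : ℝ in 𝓝[<] 0, (t : ℂ) ≠ 0 := by
    filter_upwards [self_mem_nhdsWithin] with t ht
    exact Complex.ofReal_ne_zero.mpr (ne_of_lt ht)
  have hlim : Tendsto (fun t : ℝ => (t : ℂ)) (𝓝[<] 0) (𝓝 0) := by
    simpa using (Complex.continuous_ofReal.tendsto 0).mono_left nhdsWithin_le_nhds
  have hab := eq_zero_of_bounded_div_sq_add_div hlim hne <| (hM.and hne).mono fun t ht => by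
    have h := ht.1
    rwa [wkb_conjugation hS₀ hS₁ k ht.2] at h
  exact ⟨neg_eq_zero.mp hab.1, neg_eq_zero.mp hab.2⟩
end

section
/- Let k ≥ 1 be a real number, let I ⊆ ℝ be an open interval, let y : I → ℝ be differentiable with y(u) > 0 on I and satisfying (y(u) + k) · y′(u) = −y(u) on I, and let S₁ : I → ℝ be differentiable and satisfy ½ y′(u) − ½ y(u) + (y(u) + k) · S₁′(u) = 0 on I. Then there is a constant C ∈ ℝ such that S₁(u) = −½ y(u) − ½ log( y(u) + k ) + C for all u ∈ I. -/
/-- The first semi-classical correction: if `k ≥ 1` is real, `I` is an open interval,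
`y` is positive, differentiable and satisfies `(y + k) y′ = −y` on `I`, and `S₁` is
differentiable and satisfies `½ y′ − ½ y + (y + k) S₁′ = 0` on `I`, then there is a constant
`C` with `S₁(u) = −½ y(u) − ½ log(y(u) + k) + C` on `I`. -/
theorem first_correction_S1 (k : ℝ) (hk : 1 ≤ k) (I : Set ℝ)
    (hIopen : IsOpen I) (hIconv : Convex ℝ I) (y S₁ : ℝ → ℝ)
    (hypos : ∀ u ∈ I, 0 < y u)
    (hydiff : ∀ u ∈ I, DifferentiableAt ℝ y u)
    (hode : ∀ u ∈ I, (y u + k) * deriv y u = -y u)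
    (hS₁diff : ∀ u ∈ I, DifferentiableAt ℝ S₁ u)
    (hS₁ode : ∀ u ∈ I,
      (1 / 2) * deriv y u - (1 / 2) * y u + (y u + k) * deriv S₁ u = 0) :
    ∃ C : ℝ, ∀ u ∈ I,
      S₁ u = -(1 / 2) * y u - (1 / 2) * Real.log (y u + k) + C := by
  have hpos : ∀ u ∈ I, 0 < y u + k := fun u hu => by linarith [hypos u hu]
  have hderiv : ∀ u ∈ I, HasDerivAt
      (fun v => S₁ v - (-(1 / 2) * y v - (1 / 2) * Real.log (y v + k))) 0 u := by
    intro u hu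
    have hne : y u + k ≠ 0 := (hpos u hu).ne'
    have hy := (hydiff u hu).hasDerivAt
    have h := (hS₁diff u hu).hasDerivAt.fun_sub
      ((hy.const_mul (-(1 / 2))).fun_sub (((hy.add_const k).log hne).const_mul (1 / 2)))
    refine h.congr_deriv ?_
    apply mul_left_cancel₀ hne
    field_simp
    linear_combination 2 * hS₁ode u hu + hode u hu
  obtain ⟨C, hC⟩ := hIopen.exists_is_const_of_deriv_eq_zero hIconv.isPreconnected
    (fun u hu => (hderiv u hu).differentiableAt.differentiableWithinAt)
    (fun u hu => (hderiv u hu).deriv)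
  exact ⟨C, fun u hu => by linarith [hC u hu]⟩
end
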